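/- arXiv:2309.07008 — 7 statements merged into one kernel-verified Lean document; each statement's English description precedes it below -/
import Mathlib

section
/- Let H : ℝⁿ → ℝ be continuously differentiable and bounded below by a constant B (H(y) ≥ B for all y), let λ > 0, and let x : ℝ → ℝⁿ be a continuously differentiable curve satisfying λ • x'(t) = −∇H(x(t)) for all t ≥ 0. Then the function t ↦ ‖x'(t)‖² is integrable on [0,∞) and ∫_{0}^{∞} ‖x'(t)‖² dt ≤ λ⁻¹ (H(x(0)) − B). -/
open MeasureTheory Filter Topology Set

/-- Energy dissipation along a gradient flow `lam • x' = -∇H(x)`. -/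
theorem hasDerivAt_comp_of_smul_deriv_eq_neg_gradient {E : Type*} [NormedAddCommGroup E]
    [InnerProductSpace ℝ E] [CompleteSpace E] {H : E → ℝ} {lam : ℝ} {x : ℝ → E} {t : ℝ}
    (hH : DifferentiableAt ℝ H (x t)) (hx : DifferentiableAt ℝ x t)
    (hode : lam • deriv x t = -gradient H (x t)) :
    HasDerivAt (fun s => H (x s)) (-(lam * ‖deriv x t‖ ^ 2)) t := by
  have h := hH.hasGradientAt.hasFDerivAt.comp_hasDerivAt t hx.hasDerivAt
  rw [InnerProductSpace.toDual_apply_apply, ← neg_eq_iff_eq_neg.mpr hode, inner_neg_left,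
    real_inner_smul_left, real_inner_self_eq_norm_sq] at h
  exact h

theorem stmt1 {E : Type*} [NormedAddCommGroup E] [InnerProductSpace ℝ E]
    [FiniteDimensional ℝ E]
    (H : E → ℝ) (hH : ContDiff ℝ 1 H) (B : ℝ) (hB : ∀ y, B ≤ H y)
    (lam : ℝ) (hlam : 0 < lam)
    (x : ℝ → E) (hx : ContDiff ℝ 1 x)
    (hode : ∀ t : ℝ, 0 ≤ t → lam • deriv x t = -gradient H (x t)) :
    IntegrableOn (fun t => ‖deriv x t‖ ^ 2) (Set.Ici (0 : ℝ)) ∧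
    (∫ t in Set.Ici (0 : ℝ), ‖deriv x t‖ ^ 2) ≤ lam⁻¹ * (H (x 0) - B) := by
  have hcont : Continuous fun t => ‖deriv x t‖ ^ 2 :=
    (hx.continuous_deriv le_rfl).norm.pow 2
  have hbound : ∀ T : ℝ, 0 ≤ T →
      (∫ t in (0 : ℝ)..T, ‖deriv x t‖ ^ 2) ≤ lam⁻¹ * (H (x 0) - B) := by
    intro T hT
    have hderiv : ∀ t ∈ uIcc 0 T,
        HasDerivAt (fun s => -lam⁻¹ * H (x s)) (‖deriv x t‖ ^ 2) t := by
      intro t ht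
      rw [uIcc_of_le hT] at ht
      refine ((hasDerivAt_comp_of_smul_deriv_eq_neg_gradient
        (hH.differentiable one_ne_zero (x t)) (hx.differentiable one_ne_zero t)
        (hode t ht.1)).const_mul (-lam⁻¹)).congr_deriv ?_
      rw [neg_mul_neg, inv_mul_cancel_left₀ hlam.ne']
    rw [intervalIntegral.integral_eq_sub_of_hasDerivAt hderiv (hcont.intervalIntegrable 0 T)]
    have := mul_le_mul_of_nonneg_left (hB (x T)) (inv_nonneg.mpr hlam.le)
    linarith
  have hint : IntegrableOn (fun t => ‖deriv x t‖ ^ 2) (Ioi (0 : ℝ)) := by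
    refine integrableOn_Ioi_of_intervalIntegral_norm_bounded (lam⁻¹ * (H (x 0) - B)) 0
      (fun T => hcont.integrableOn_Ioc) tendsto_id ?_
    filter_upwards [eventually_ge_atTop 0] with T hT
    simpa using hbound T hT
  refine ⟨Iff.mpr integrableOn_Ici_iff_integrableOn_Ioi hint, ?_⟩
  rw [integral_Ici_eq_integral_Ioi]
  refine le_of_tendsto (intervalIntegral_tendsto_integral_Ioi 0 hint tendsto_id) ?_
  filter_upwards [eventually_ge_atTop 0] with T hT using hbound T hT
end

section
/- Let H : ℝⁿ → ℝ be continuously differentiable and bounded below, let λ > 0, and let x : ℝ → ℝⁿ be a continuously differentiable curve satisfying λ • x'(t) = −∇H(x(t)) for all t ≥ 0. Then H(x(t)) converges to a finite limit H̄ as t → ∞, and for every cluster point x∞ of the trajectory (i.e. every x∞ such that x(t_k) → x∞ for some sequence t_k → ∞) one has H(x∞) = H̄. -/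
open MeasureTheory Filter Topology Set

theorem hasDerivAt_comp_of_gradientFlow {E : Type*} [NormedAddCommGroup E]
    [InnerProductSpace ℝ E] [CompleteSpace E] {H : E → ℝ} {x : ℝ → E} {lam t : ℝ}
    (hH : DifferentiableAt ℝ H (x t)) (hx : DifferentiableAt ℝ x t)
    (hode : lam • deriv x t = -gradient H (x t)) :
    HasDerivAt (fun s => H (x s)) (-(lam * ‖deriv x t‖ ^ 2)) t := by
  have h := hH.hasGradientAt.hasFDerivAt.comp_hasDerivAt t hx.hasDerivAt
  have hgrad : gradient H (x t) = -(lam • deriv x t) := by rw [hode, neg_neg]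
  rw [hgrad, InnerProductSpace.toDual_apply_apply, inner_neg_left, real_inner_smul_left,
    real_inner_self_eq_norm_sq] at h
  exact h

theorem tendsto_atTop_of_antitoneOn_Ici {f : ℝ → ℝ} {a B : ℝ} (hf : AntitoneOn f (Ici a))
    (hB : ∀ t, B ≤ f t) : ∃ l, Tendsto f atTop (𝓝 l) := by
  have hanti : Antitone fun t => f (max t a) := fun s t hst =>
    hf (le_max_right s a) (le_max_right t a) (max_le_max_right a hst)
  have hbdd : BddBelow (range fun t => f (max t a)) := ⟨B, by rintro _ ⟨t, rfl⟩; exact hB _⟩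
  refine ⟨_, (tendsto_atTop_ciInf hanti hbdd).congr' ?_⟩
  filter_upwards [eventually_ge_atTop a] with t ht
  rw [max_eq_left ht]

theorem stmt2 {E : Type*} [NormedAddCommGroup E] [InnerProductSpace ℝ E]
    [FiniteDimensional ℝ E]
    (H : E → ℝ) (hH : ContDiff ℝ 1 H) (hbdd : ∃ B : ℝ, ∀ y, B ≤ H y)
    (lam : ℝ) (hlam : 0 < lam)
    (x : ℝ → E) (hx : ContDiff ℝ 1 x)
    (hode : ∀ t : ℝ, 0 ≤ t → lam • deriv x t = -gradient H (x t)) :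
    ∃ Hbar : ℝ, Tendsto (fun t => H (x t)) atTop (𝓝 Hbar) ∧
      ∀ (xinf : E) (tk : ℕ → ℝ), Tendsto tk atTop atTop →
        Tendsto (fun k => x (tk k)) atTop (𝓝 xinf) → H xinf = Hbar := by
  obtain ⟨B, hB⟩ := hbdd
  have hHd : Differentiable ℝ H := hH.differentiable one_ne_zero
  have hxd : Differentiable ℝ x := hx.differentiable one_ne_zero
  have hanti : AntitoneOn (fun t => H (x t)) (Ici 0) := by
    refine antitoneOn_of_deriv_nonpos (convex_Ici 0) (hHd.comp hxd).continuous.continuousOn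
      (hHd.comp hxd).differentiableOn fun t ht => ?_
    rw [(hasDerivAt_comp_of_gradientFlow (hHd _) (hxd t) (hode t (interior_subset ht))).deriv,
      neg_nonpos]
    positivity
  obtain ⟨l, hl⟩ := tendsto_atTop_of_antitoneOn_Ici hanti fun t => hB (x t)
  exact ⟨l, hl, fun xinf tk htk hxk =>
    tendsto_nhds_unique ((hH.continuous.tendsto xinf).comp hxk) (hl.comp htk)⟩
end

section
/- Let H : ℝⁿ → ℝ be continuously differentiable, let λ > 0, and let x : ℝ → ℝⁿ be a continuously differentiable curve satisfying λ • x'(t) = −∇H(x(t)) for all t ≥ 0. Let H̄ ∈ ℝ, σ > 0 and T₀ ≥ 0, and assume that for all t ≥ T₀: H(x(t)) > H̄ and σ · ‖∇H(x(t))‖ ≥ (H(x(t)) − H̄)^{1/2}. Then for all t ≥ T₀ one has the exponential decay H(x(t)) − H̄ ≤ (H(x(T₀)) − H̄) · exp(−(t − T₀)/(σ²λ)). -/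
open Filter Topology Set

/-- If the derivative of a function is at most `-c` times the function on `[a, ∞)`, then the function
decays exponentially with rate `c`. -/
theorem le_mul_exp_of_hasDerivAt_le_neg_mul {f f' : ℝ → ℝ} {a c : ℝ}
    (hf : ∀ t, a ≤ t → HasDerivAt f (f' t) t) (hle : ∀ t, a ≤ t → f' t ≤ -c * f t)
    {t : ℝ} (ht : a ≤ t) : f t ≤ f a * Real.exp (-c * (t - a)) := by
  have hexp (s : ℝ) : HasDerivAt (fun s => Real.exp (c * (s - a)))
      (Real.exp (c * (s - a)) * c) s := by
    simpa using (((hasDerivAt_id s).sub_const a).const_mul c).exp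
  have hderiv (s : ℝ) (hs : a ≤ s) := (hf s hs).mul (hexp s)
  have hanti : AntitoneOn (f * fun s => Real.exp (c * (s - a))) (Ici a) := by
    refine antitoneOn_of_hasDerivWithinAt_nonpos (convex_Ici a)
      (fun s hs => (hderiv s hs).continuousAt.continuousWithinAt)
      (fun s hs => (hderiv s (interior_subset hs)).hasDerivWithinAt) fun s hs => ?_
    nlinarith [hle s (interior_subset hs), Real.exp_pos (c * (s - a))]
  have h : f t * Real.exp (c * (t - a)) ≤ f a := by
    simpa using hanti self_mem_Ici ht ht
  rw [neg_mul, Real.exp_neg, ← div_eq_mul_inv]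
  exact (le_div_iff₀ (Real.exp_pos _)).2 h

/-- Chain rule along a curve, expressed with the gradient. -/
theorem HasGradientAt.comp_hasDerivAt_curve {E : Type*} [NormedAddCommGroup E]
    [InnerProductSpace ℝ E] [CompleteSpace E] {H : E → ℝ} {x : ℝ → E} {g v : E} {t : ℝ}
    (hH : HasGradientAt H g (x t)) (hx : HasDerivAt x v t) :
    HasDerivAt (fun s => H (x s)) (inner ℝ g v) t := by
  simpa [Function.comp_def] using hH.hasFDerivAt.comp_hasDerivAt t hx

theorem stmt6 {E : Type*} [NormedAddCommGroup E] [InnerProductSpace ℝ E]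
    [FiniteDimensional ℝ E]
    (H : E → ℝ) (hH : ContDiff ℝ 1 H) (lam : ℝ) (hlam : 0 < lam)
    (x : ℝ → E) (hx : ContDiff ℝ 1 x)
    (hode : ∀ t : ℝ, 0 ≤ t → lam • deriv x t = -gradient H (x t))
    (Hbar σ T₀ : ℝ) (hσ : 0 < σ) (hT₀ : 0 ≤ T₀)
    (hpos : ∀ t, T₀ ≤ t → Hbar < H (x t))
    (hKL : ∀ t, T₀ ≤ t →
      (H (x t) - Hbar) ^ ((1 : ℝ) / 2) ≤ σ * ‖gradient H (x t)‖) :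
    ∀ t, T₀ ≤ t →
      H (x t) - Hbar ≤ (H (x T₀) - Hbar) * Real.exp (-(t - T₀) / (σ ^ 2 * lam)) := by
  have hderiv (t : ℝ) : HasDerivAt (fun s => H (x s) - Hbar)
      (inner ℝ (gradient H (x t)) (deriv x t)) t :=
    ((hH.differentiable one_ne_zero (x t)).hasGradientAt.comp_hasDerivAt_curve
      (hx.differentiable one_ne_zero t).hasDerivAt).sub_const Hbar
  intro t ht
  have hdecay := le_mul_exp_of_hasDerivAt_le_neg_mul (c := 1 / (σ ^ 2 * lam))
    (fun s _ => hderiv s) (fun s hs => ?_) ht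
  · convert hdecay using 3
    ring
  have hdiss : lam * inner ℝ (gradient H (x s)) (deriv x s) = -‖gradient H (x s)‖ ^ 2 := by
    rw [← real_inner_smul_right, hode s (hT₀.trans hs), inner_neg_right,
      real_inner_self_eq_norm_sq]
  have hsq : H (x s) - Hbar ≤ σ ^ 2 * ‖gradient H (x s)‖ ^ 2 := by
    have h := hKL s hs
    rw [← Real.sqrt_eq_rpow, Real.sqrt_le_left (by positivity), mul_pow] at h
    exact h
  rw [neg_mul, one_div_mul_eq_div, ← neg_div, le_div_iff₀ (by positivity)]
  linear_combination hsq + σ ^ 2 * hdiss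
end

section
/- Let H : ℝⁿ → ℝ be continuously differentiable, let λ > 0, and let x : ℝ → ℝⁿ be a continuously differentiable curve satisfying λ • x'(t) = −∇H(x(t)) for all t ≥ 0. Let H̄ ∈ ℝ, σ > 0, θ ∈ (0,1) and T₀ ≥ 0, and assume that for all t ≥ T₀: H(x(t)) > H̄ and σ(1−θ) · ‖∇H(x(t))‖ ≥ (H(x(t)) − H̄)^{θ}. Then x(t) converges to a limit x∞ as t → ∞, and for every t ≥ T₀ one has ‖x(t) − x∞‖ ≤ σ (H(x(t)) − H̄)^{1−θ}. -/
open Filter Topology Set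

/-- A curve whose increments are controlled by the decrease of a nonnegative function converges,
and that function bounds the distance to the limit. -/
theorem exists_tendsto_norm_sub_le_of_norm_sub_le_sub {E : Type*} [NormedAddCommGroup E]
    [CompleteSpace E] {x : ℝ → E} {φ : ℝ → ℝ} {T : ℝ} (hφ : ∀ t, T ≤ t → 0 ≤ φ t)
    (hx : ∀ s t, T ≤ s → s ≤ t → ‖x t - x s‖ ≤ φ s - φ t) :
    ∃ y : E, Tendsto x atTop (𝓝 y) ∧ ∀ t, T ≤ t → ‖x t - y‖ ≤ φ t := by
  have hbdd : BddBelow (φ '' Ici T) := ⟨0, by rintro _ ⟨t, ht, rfl⟩; exact hφ t ht⟩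
  have hc : CauchySeq x := by
    refine Metric.cauchySeq_iff'.2 fun ε hε => ?_
    obtain ⟨_, ⟨N, hN, rfl⟩, hlt⟩ := Real.lt_sInf_add_pos (nonempty_Ici.image φ) hε
    refine ⟨N, fun t ht => ?_⟩
    have hinf : sInf (φ '' Ici T) ≤ φ t := csInf_le hbdd ⟨t, le_trans hN ht, rfl⟩
    rw [dist_eq_norm]
    linarith [hx N t hN ht]
  obtain ⟨y, hy⟩ := cauchySeq_tendsto_of_complete hc
  refine ⟨y, hy, fun s hs => ?_⟩
  rw [norm_sub_rev]
  refine le_of_tendsto (hy.sub_const (x s)).norm ?_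
  filter_upwards [eventually_ge_atTop s] with t ht
  linarith [hx s t hs ht, hφ t (hs.trans ht)]

/-- If the speed of a curve is at most the rate of decrease of `φ`, then its increments are bounded
by those of `φ`. -/
theorem norm_sub_le_sub_of_norm_deriv_le_neg {E : Type*} [NormedAddCommGroup E]
    [NormedSpace ℝ E] {x x' : ℝ → E} {φ φ' : ℝ → ℝ} {T : ℝ}
    (hx : ∀ t, T ≤ t → HasDerivAt x (x' t) t) (hφ : ∀ t, T ≤ t → HasDerivAt φ (φ' t) t)
    (hle : ∀ t, T ≤ t → ‖x' t‖ ≤ -φ' t) {s t : ℝ} (hs : T ≤ s) (hst : s ≤ t) :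
    ‖x t - x s‖ ≤ φ s - φ t := by
  have hd : ∀ u, T ≤ u → HasDerivAt (fun v => x v - x s) (x' u) u :=
    fun u hu => (hx u hu).sub_const (x s)
  have hB : ∀ u, T ≤ u → HasDerivAt (fun v => φ s - φ v) (-φ' u) u :=
    fun u hu => (hφ u hu).const_sub (φ s)
  exact image_norm_le_of_norm_deriv_right_le_deriv_boundary' (a := s) (b := t)
    (fun u hu => (hd u (hs.trans hu.1)).continuousAt.continuousWithinAt)
    (fun u hu => (hd u (hs.trans hu.1)).hasDerivWithinAt) (by simp)
    (fun u hu => (hB u (hs.trans hu.1)).continuousAt.continuousWithinAt)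
    (fun u hu => (hB u (hs.trans hu.1)).hasDerivWithinAt)
    (fun u hu => hle u (hs.trans hu.1)) (right_mem_Icc.2 hst)

theorem stmt8 {E : Type*} [NormedAddCommGroup E] [InnerProductSpace ℝ E]
    [FiniteDimensional ℝ E]
    (H : E → ℝ) (hH : ContDiff ℝ 1 H) (lam : ℝ) (hlam : 0 < lam)
    (x : ℝ → E) (hx : ContDiff ℝ 1 x)
    (hode : ∀ t : ℝ, 0 ≤ t → lam • deriv x t = -gradient H (x t))
    (Hbar σ θ T₀ : ℝ) (hσ : 0 < σ) (hθ : θ ∈ Set.Ioo (0 : ℝ) 1) (hT₀ : 0 ≤ T₀)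
    (hpos : ∀ t, T₀ ≤ t → Hbar < H (x t))
    (hKL : ∀ t, T₀ ≤ t →
      (H (x t) - Hbar) ^ θ ≤ σ * (1 - θ) * ‖gradient H (x t)‖) :
    ∃ xinf : E, Tendsto x atTop (𝓝 xinf) ∧
      ∀ t, T₀ ≤ t → ‖x t - xinf‖ ≤ σ * (H (x t) - Hbar) ^ (1 - θ) := by
  have hxd : ∀ t, HasDerivAt x (deriv x t) t :=
    fun t => (hx.differentiable one_ne_zero t).hasDerivAt
  have hgrad : ∀ t, T₀ ≤ t → gradient H (x t) = -(lam • deriv x t) := fun t ht => by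
    rw [hode t (hT₀.trans ht), neg_neg]
  have hHx : ∀ t, T₀ ≤ t →
      HasDerivAt (fun s => H (x s)) (-(lam * ‖deriv x t‖ ^ 2)) t := fun t ht => by
    have h := (hH.differentiable one_ne_zero (x t)).hasGradientAt.hasFDerivAt.comp_hasDerivAt t
      (hxd t)
    rw [InnerProductSpace.toDual_apply_apply, hgrad t ht, inner_neg_left, real_inner_smul_left,
      real_inner_self_eq_norm_sq] at h
    exact h
  have hφ : ∀ t, T₀ ≤ t → HasDerivAt (fun s => σ * (H (x s) - Hbar) ^ (1 - θ))
      (σ * (-(lam * ‖deriv x t‖ ^ 2) * (1 - θ) * (H (x t) - Hbar) ^ (1 - θ - 1))) t :=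
    fun t ht => (((hHx t ht).sub_const Hbar).rpow_const
      (Or.inl (sub_pos.2 (hpos t ht)).ne')).const_mul σ
  refine exists_tendsto_norm_sub_le_of_norm_sub_le_sub
    (fun t ht => mul_nonneg hσ.le (Real.rpow_nonneg (sub_pos.2 (hpos t ht)).le _))
    fun s t hs hst => norm_sub_le_sub_of_norm_deriv_le_neg (fun t _ => hxd t) hφ
      (fun t ht => ?_) hs hst
  have hg : 0 < H (x t) - Hbar := sub_pos.2 (hpos t ht)
  have hk := hKL t ht
  rw [hgrad t ht, norm_neg, norm_smul, Real.norm_of_nonneg hlam.le] at hk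
  rw [show 1 - θ - 1 = -θ by ring, Real.rpow_neg hg.le]
  have hp := Real.rpow_pos_of_pos hg θ
  calc ‖deriv x t‖ = ‖deriv x t‖ * (H (x t) - Hbar) ^ θ * ((H (x t) - Hbar) ^ θ)⁻¹ := by
        field_simp
    _ ≤ ‖deriv x t‖ * (σ * (1 - θ) * (lam * ‖deriv x t‖)) * ((H (x t) - Hbar) ^ θ)⁻¹ := by
        gcongr
    _ = _ := by ring
end

section
/- Let H : ℝⁿ → ℝ be differentiable with L-Lipschitz gradient (L > 0), let λ, γ, α > 0, and let c satisfy 0 < c < min{2λ/L, (√(L² + 2λγL) − L)/L}; set a := λγ − cL − c²L/2 and b := cλ − c²L/2 (both positive under this choice of c). Let x : (0,∞) → ℝⁿ be twice continuously differentiable and satisfy λ x''(t) + λ(γ + α/t) x'(t) + ∇H(x(t)) = 0 for all t > 0, and define V(t) := H(x(t) + c • x'(t)) + (λ/2)(1 + cγ + cα/t) ‖x'(t)‖². Then V is differentiable on (0,∞) and V'(t) ≤ −a ‖x'(t)‖² − b ‖x''(t)‖² for all t > 0. -/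
open Filter Topology Set

/-- The derivative of the Lyapunov function along a twice differentiable curve. -/
theorem hasDerivAt_lyapunov {E : Type*} [NormedAddCommGroup E] [InnerProductSpace ℝ E]
    [CompleteSpace E] {H : E → ℝ} {lam γ α c t : ℝ} (ht : 0 < t) {x v : ℝ → E} {w : E}
    (hH : DifferentiableAt ℝ H (x t + c • v t))
    (hx : HasDerivAt x (v t) t) (hv : HasDerivAt v w t) :
    HasDerivAt
      (fun s => H (x s + c • v s) + lam / 2 * (1 + c * γ + c * α / s) * ‖v s‖ ^ 2)
      (inner ℝ (gradient H (x t + c • v t)) (v t + c • w)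
        + lam * (1 + c * γ + c * α / t) * inner ℝ (v t) w
        - lam * (c * α / t ^ 2) / 2 * ‖v t‖ ^ 2) t := by
  have hcomp := hH.hasGradientAt.hasFDerivAt.comp_hasDerivAt t (hx.add (hv.const_smul c))
  have hcoef : HasDerivAt (fun s : ℝ => lam / 2 * (1 + c * γ + c * α / s))
      (lam / 2 * (c * α * -(t ^ 2)⁻¹)) t := by
    simpa only [div_eq_mul_inv (c * α)] using
      (((hasDerivAt_inv ht.ne').const_mul (c * α)).const_add (1 + c * γ)).const_mul (lam / 2)
  refine (hcomp.add (hcoef.mul hv.norm_sq)).congr_deriv ?_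
  simp only [InnerProductSpace.toDual_apply_apply]
  ring

/-- The expression for the derivative of the Lyapunov function is bounded above along the
damped gradient dynamics, where `v`, `w`, `g`, `G` are the velocity, the acceleration, and the
gradients at the current and at the extrapolated position. -/
theorem lyapunov_dissipation {E : Type*} [NormedAddCommGroup E] [InnerProductSpace ℝ E]
    {L lam γ α c t : ℝ} (hL : 0 ≤ L) (hlam : 0 ≤ lam) (hα : 0 ≤ α) (hc : 0 ≤ c) (ht : 0 < t)
    {v w g G : E} (hode : lam • w + (lam * (γ + α / t)) • v + g = 0)
    (hG : ‖G - g‖ ≤ L * (c * ‖v‖)) :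
    inner ℝ G (v + c • w) + lam * (1 + c * γ + c * α / t) * inner ℝ v w
        - lam * (c * α / t ^ 2) / 2 * ‖v‖ ^ 2
      ≤ -(lam * γ - c * L - c ^ 2 * L / 2) * ‖v‖ ^ 2
        - (c * lam - c ^ 2 * L / 2) * ‖w‖ ^ 2 := by
  have hdiff : inner ℝ (G - g) (v + c • w)
      ≤ c * L * ‖v‖ ^ 2 + c ^ 2 * L / 2 * (‖v‖ ^ 2 + ‖w‖ ^ 2) := by
    have hsum : ‖v + c • w‖ ≤ ‖v‖ + c * ‖w‖ := by
      simpa [norm_smul, abs_of_nonneg hc] using norm_add_le v (c • w)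
    calc inner ℝ (G - g) (v + c • w)
        ≤ ‖G - g‖ * ‖v + c • w‖ := real_inner_le_norm _ _
      _ ≤ L * (c * ‖v‖) * (‖v‖ + c * ‖w‖) := by gcongr
      _ ≤ _ := by
        have := mul_nonneg (mul_nonneg (sq_nonneg c) hL) (sq_nonneg (‖v‖ - ‖w‖))
        linarith
  have hinner : inner ℝ g (v + c • w) =
      -(lam * (γ + α / t)) * ‖v‖ ^ 2 - c * lam * ‖w‖ ^ 2
        - lam * (1 + c * γ + c * α / t) * inner ℝ v w := by
    rw [eq_neg_of_add_eq_zero_right hode]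
    simp only [inner_neg_left, inner_add_left, inner_add_right, real_inner_smul_left,
      real_inner_smul_right, real_inner_self_eq_norm_sq, real_inner_comm v w]
    ring
  rw [inner_sub_left] at hdiff
  have hdamp : 0 ≤ lam * (α / t) * ‖v‖ ^ 2 := by positivity
  have hdecay : 0 ≤ lam * (c * α / t ^ 2) / 2 * ‖v‖ ^ 2 := by positivity
  linarith

theorem stmt12 {E : Type*} [NormedAddCommGroup E] [InnerProductSpace ℝ E]
    [FiniteDimensional ℝ E]
    (H : E → ℝ) (hH : Differentiable ℝ H) (L : ℝ) (hL : 0 < L)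
    (hLip : ∀ u v : E, ‖gradient H u - gradient H v‖ ≤ L * ‖u - v‖)
    (lam γ α c : ℝ) (hlam : 0 < lam) (hγ : 0 < γ) (hα : 0 < α)
    (hc0 : 0 < c)
    (hc1 : c < min (2 * lam / L) ((Real.sqrt (L ^ 2 + 2 * lam * γ * L) - L) / L))
    (a b : ℝ) (ha : a = lam * γ - c * L - c ^ 2 * L / 2)
    (hb : b = c * lam - c ^ 2 * L / 2)
    (x : ℝ → E) (hx : ContDiffOn ℝ 2 x (Set.Ioi 0))
    (hode : ∀ t : ℝ, 0 < t →
      lam • deriv (deriv x) t + (lam * (γ + α / t)) • deriv x t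
        + gradient H (x t) = 0)
    (V : ℝ → ℝ)
    (hV : ∀ t : ℝ, V t = H (x t + c • deriv x t)
        + lam / 2 * (1 + c * γ + c * α / t) * ‖deriv x t‖ ^ 2) :
    (∀ t : ℝ, 0 < t → DifferentiableAt ℝ V t) ∧
    (∀ t : ℝ, 0 < t →
      deriv V t ≤ -a * ‖deriv x t‖ ^ 2 - b * ‖deriv (deriv x) t‖ ^ 2) := by
  have hderiv (t : ℝ) (ht : 0 < t) : ∃ V' : ℝ, HasDerivAt V V' t ∧
      V' ≤ -a * ‖deriv x t‖ ^ 2 - b * ‖deriv (deriv x) t‖ ^ 2 := by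
    have hxt : HasDerivAt x (deriv x t) t :=
      ((hx.differentiableOn (by norm_num)).differentiableAt (Ioi_mem_nhds ht)).hasDerivAt
    have hvt : HasDerivAt (deriv x) (deriv (deriv x) t) t :=
      (((hx.deriv_of_isOpen isOpen_Ioi (m := 1) (by norm_num)).differentiableOn
        (by norm_num)).differentiableAt (Ioi_mem_nhds ht)).hasDerivAt
    have hVt := hasDerivAt_lyapunov (lam := lam) (γ := γ) (α := α) (c := c) ht
      (hH _) hxt hvt
    rw [← funext hV] at hVt
    refine ⟨_, hVt, ?_⟩
    subst ha hb
    have hgrad : ‖gradient H (x t + c • deriv x t) - gradient H (x t)‖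
        ≤ L * (c * ‖deriv x t‖) := by
      simpa [norm_smul, abs_of_pos hc0] using hLip (x t + c • deriv x t) (x t)
    exact lyapunov_dissipation hL.le hlam.le hα.le hc0.le ht (hode t ht) hgrad
  refine ⟨fun t ht => ?_, fun t ht => ?_⟩
  · obtain ⟨_, h, -⟩ := hderiv t ht
    exact h.differentiableAt
  · obtain ⟨_, h, hle⟩ := hderiv t ht
    exact h.deriv.trans_le hle
end

section
/- Let H : ℝⁿ → ℝ be differentiable with L-Lipschitz gradient (L > 0) and bounded below, let λ, γ, α > 0, and let c satisfy 0 < c < min{2λ/L, (√(L² + 2λγL) − L)/L}. Let x : (0,∞) → ℝⁿ be twice continuously differentiable and satisfy λ x''(t) + λ(γ + α/t) x'(t) + ∇H(x(t)) = 0 for all t > 0. Then for every t₀ > 0 the functions t ↦ ‖x'(t)‖² and t ↦ ‖x''(t)‖² are integrable on [t₀, ∞), and x'(t) → 0 as t → ∞. -/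
open MeasureTheory Filter Topology Set

theorem integrableOn_Ici_of_deriv_le_neg {U U' p : ℝ → ℝ} {B t₀ : ℝ}
    (hU : ∀ t ∈ Ici t₀, HasDerivAt U (U' t) t) (hB : ∀ t ∈ Ici t₀, B ≤ U t)
    (hp : ContinuousOn p (Ici t₀)) (hp0 : ∀ t ∈ Ici t₀, 0 ≤ p t)
    (hUp : ∀ t ∈ Ici t₀, U' t ≤ -p t) : IntegrableOn p (Ici t₀) := by
  have hanti : AntitoneOn U (Ici t₀) := by
    refine antitoneOn_of_deriv_nonpos (convex_Ici t₀)
      (fun t ht => (hU t ht).continuousAt.continuousWithinAt)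
      (fun t ht => (hU t (interior_subset ht)).differentiableAt.differentiableWithinAt) ?_
    intro t ht
    rw [(hU t (interior_subset ht)).deriv]
    linarith [hUp t (interior_subset ht), hp0 t (interior_subset ht)]
  have hanti' : Antitone fun t => U (max t t₀) := fun s t hst =>
    hanti (le_max_right s t₀) (le_max_right t t₀) (max_le_max_right t₀ hst)
  have hbdd : BddBelow (range fun t => U (max t t₀)) :=
    ⟨B, by rintro _ ⟨t, rfl⟩; exact hB _ (le_max_right t t₀)⟩
  have hlim := (tendsto_atTop_ciInf hanti' hbdd).congr' (f₂ := U) (by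
    filter_upwards [eventually_ge_atTop t₀] with t ht
    rw [max_eq_left ht])
  have hint : IntegrableOn U' (Ioi t₀) :=
    integrableOn_Ioi_deriv_of_nonpos (hU t₀ self_mem_Ici).continuousAt.continuousWithinAt
      (fun t ht => hU t (Ioi_subset_Ici_self ht))
      (fun t ht => by
        linarith [hUp t (Ioi_subset_Ici_self ht), hp0 t (Ioi_subset_Ici_self ht)]) hlim
  rw [integrableOn_Ici_iff_integrableOn_Ioi]
  refine Integrable.mono' hint.neg
    ((hp.mono Ioi_subset_Ici_self).aestronglyMeasurable measurableSet_Ioi) ?_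
  filter_upwards [ae_restrict_mem measurableSet_Ioi] with t ht
  have ht' := Ioi_subset_Ici_self ht
  rw [Real.norm_of_nonneg (hp0 t ht'), Pi.neg_apply]
  linarith [hUp t ht']

theorem hasDerivAt_comp_inner_gradient {E : Type*} [NormedAddCommGroup E] [InnerProductSpace ℝ E]
    [CompleteSpace E] {H : E → ℝ} {y : ℝ → E} {y' : E} {t : ℝ}
    (hH : DifferentiableAt ℝ H (y t)) (hy : HasDerivAt y y' t) :
    HasDerivAt (fun s => H (y s)) (inner ℝ (gradient H (y t)) y') t := by
  simpa [Function.comp_def] using hH.hasFDerivAt.comp_hasDerivAt t hy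

theorem lyapunov_deriv_le {E : Type*} [NormedAddCommGroup E] [InnerProductSpace ℝ E]
    {L lam γ a K t : ℝ} {u v G G₁ : E} (hlam : 0 < lam) (ha : 0 < a)
    (hL : 0 < L) (hK : K * (lam * γ) = L + L ^ 2 / (2 * lam) + 1) (hγ : 0 < γ)
    (hode : lam • v + (lam * (γ + a / t)) • u + G = 0) (ht : 0 < t)
    (hG : ‖G₁ - G‖ ≤ L * ‖u‖) :
    inner ℝ G₁ (u + v) +
        (lam / 2 * (-a / t ^ 2) * ‖u‖ ^ 2 +
          lam / 2 * (1 + γ + a / t) * (2 * inner ℝ u v)) +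
        K * (inner ℝ G u + lam / 2 * (2 * inner ℝ u v)) ≤
      -(‖u‖ ^ 2 + lam / 2 * ‖v‖ ^ 2) := by
  have hGu : inner ℝ G u = -(lam * inner ℝ u v) - lam * (γ + a / t) * ‖u‖ ^ 2 := by
    have h := congrArg (fun w => inner ℝ w u) hode
    simp only [inner_add_left, real_inner_smul_left, inner_zero_left,
      real_inner_self_eq_norm_sq, real_inner_comm u v] at h
    linarith
  have hGv : inner ℝ G v = -(lam * ‖v‖ ^ 2) - lam * (γ + a / t) * inner ℝ u v := by
    have h := congrArg (fun w => inner ℝ w v) hode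
    simp only [inner_add_left, real_inner_smul_left, inner_zero_left,
      real_inner_self_eq_norm_sq] at h
    linarith
  have herr : inner ℝ G₁ (u + v) ≤
      inner ℝ G u + inner ℝ G v + L * ‖u‖ * (‖u‖ + ‖v‖) := by
    have h1 : inner ℝ (G₁ - G) (u + v) ≤ L * ‖u‖ * (‖u‖ + ‖v‖) :=
      (real_inner_le_norm _ _).trans
        (mul_le_mul hG (norm_add_le u v) (norm_nonneg _) (by positivity))
    rw [inner_sub_left, inner_add_right G] at h1
    linarith
  have hyoung : L * ‖u‖ * ‖v‖ ≤ L ^ 2 / (2 * lam) * ‖u‖ ^ 2 + lam / 2 * ‖v‖ ^ 2 := by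
    have : L ^ 2 / (2 * lam) * ‖u‖ ^ 2 + lam / 2 * ‖v‖ ^ 2 - L * ‖u‖ * ‖v‖ =
        (L * ‖u‖ - lam * ‖v‖) ^ 2 / (2 * lam) := by
      field_simp
      ring
    have : 0 ≤ (L * ‖u‖ - lam * ‖v‖) ^ 2 / (2 * lam) := by positivity
    linarith
  have hK0 : 0 < K := by
    refine pos_of_mul_pos_left (b := lam * γ) ?_ (by positivity)
    rw [hK]
    positivity
  have hdamp : 0 ≤ lam * (γ + a / t) * ‖u‖ ^ 2 := by positivity
  have hdampK : 0 ≤ K * (lam * (a / t) * ‖u‖ ^ 2) := by positivity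
  have hdecay : lam / 2 * (-a / t ^ 2) * ‖u‖ ^ 2 ≤ 0 := by
    have : 0 ≤ lam / 2 * (a / t ^ 2) * ‖u‖ ^ 2 := by positivity
    rw [neg_div]
    linarith
  have hKu : K * (lam * γ) * ‖u‖ ^ 2 = (L + L ^ 2 / (2 * lam) + 1) * ‖u‖ ^ 2 := by rw [hK]
  rw [hGu, hGv] at herr
  rw [hGu]
  linarith

theorem stmt13 {E : Type*} [NormedAddCommGroup E] [InnerProductSpace ℝ E]
    [FiniteDimensional ℝ E]
    (H : E → ℝ) (hH : Differentiable ℝ H) (L : ℝ) (hL : 0 < L)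
    (hLip : ∀ u v : E, ‖gradient H u - gradient H v‖ ≤ L * ‖u - v‖)
    (hbdd : ∃ B : ℝ, ∀ y, B ≤ H y)
    (lam γ α c : ℝ) (hlam : 0 < lam) (hγ : 0 < γ) (hα : 0 < α)
    (hc0 : 0 < c)
    (hc1 : c < min (2 * lam / L) ((Real.sqrt (L ^ 2 + 2 * lam * γ * L) - L) / L))
    (x : ℝ → E) (hx : ContDiffOn ℝ 2 x (Set.Ioi 0))
    (hode : ∀ t : ℝ, 0 < t →
      lam • deriv (deriv x) t + (lam * (γ + α / t)) • deriv x t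
        + gradient H (x t) = 0) :
    (∀ t₀ : ℝ, 0 < t₀ →
      IntegrableOn (fun t => ‖deriv x t‖ ^ 2) (Set.Ici t₀) ∧
      IntegrableOn (fun t => ‖deriv (deriv x) t‖ ^ 2) (Set.Ici t₀)) ∧
    Tendsto (deriv x) atTop (𝓝 0) := by
  obtain ⟨B, hB⟩ := hbdd
  have hx1 : ContDiffOn ℝ 1 (deriv x) (Ioi 0) :=
    hx.deriv_of_isOpen isOpen_Ioi (by norm_num)
  have hx2 : ContinuousOn (deriv (deriv x)) (Ioi 0) :=
    hx1.continuousOn_deriv_of_isOpen isOpen_Ioi le_rfl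
  have hdx (t : ℝ) (ht : 0 < t) : HasDerivAt x (deriv x t) t :=
    ((hx.differentiableOn (by norm_num)).differentiableAt (Ioi_mem_nhds ht)).hasDerivAt
  have hdx' (t : ℝ) (ht : 0 < t) : HasDerivAt (deriv x) (deriv (deriv x) t) t :=
    ((hx1.differentiableOn (by norm_num)).differentiableAt (Ioi_mem_nhds ht)).hasDerivAt
  obtain ⟨K, hK⟩ : ∃ K : ℝ, K * (lam * γ) = L + L ^ 2 / (2 * lam) + 1 :=
    ⟨(L + L ^ 2 / (2 * lam) + 1) / (lam * γ), div_mul_cancel₀ _ (by positivity)⟩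
  have hK0 : 0 < K := by
    refine pos_of_mul_pos_left (b := lam * γ) ?_ (by positivity)
    rw [hK]
    positivity
  have hint (t₀ : ℝ) (ht₀ : 0 < t₀) : IntegrableOn
      (fun t => ‖deriv x t‖ ^ 2 + lam / 2 * ‖deriv (deriv x) t‖ ^ 2) (Ici t₀) := by
    have hsub : Ici t₀ ⊆ Ioi 0 := fun t ht => lt_of_lt_of_le ht₀ ht
    refine integrableOn_Ici_of_deriv_le_neg
      (U := fun t => H (x t + deriv x t) + lam / 2 * (1 + γ + α / t) * ‖deriv x t‖ ^ 2 +
        K * (H (x t) + lam / 2 * ‖deriv x t‖ ^ 2)) (B := B + K * B) ?_ ?_ ?_ ?_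
      (fun t ht => lyapunov_deriv_le hlam hα hL hK hγ (hode t (hsub ht)) (hsub ht)
        (G₁ := gradient H (x t + deriv x t)) ?_)
    · intro t ht
      have ht0 : 0 < t := hsub ht
      have hv := hdx' t ht0
      have hdiv : HasDerivAt (fun s => lam / 2 * (1 + γ + α / s))
          (lam / 2 * (-α / t ^ 2)) t := by
        have h := ((hasDerivAt_const t α).div (hasDerivAt_id t) ht0.ne').const_add (1 + γ)
        have h := h.const_mul (lam / 2)
        simpa using h
      exact ((hasDerivAt_comp_inner_gradient (hH _) ((hdx t ht0).add hv)).add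
        (hdiv.mul hv.norm_sq)).add
        (((hasDerivAt_comp_inner_gradient (hH _) (hdx t ht0)).add
          (hv.norm_sq.const_mul (lam / 2))).const_mul K)
    · intro t ht
      have ht0 : 0 < t := hsub ht
      have h1 : 0 ≤ lam / 2 * (1 + γ + α / t) * ‖deriv x t‖ ^ 2 := by positivity
      have h2 : K * B ≤ K * (H (x t) + lam / 2 * ‖deriv x t‖ ^ 2) := by
        have : 0 ≤ lam / 2 * ‖deriv x t‖ ^ 2 := by positivity
        gcongr
        linarith [hB (x t)]
      linarith [hB (x t + deriv x t)]
    · exact ((hx1.continuousOn.mono hsub).norm.pow 2).add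
        (continuousOn_const.mul ((hx2.mono hsub).norm.pow 2))
    · intro t _
      positivity
    · simpa using hLip (x t + deriv x t) (x t)
  have hL2 (t₀ : ℝ) (ht₀ : 0 < t₀) :
      IntegrableOn (fun t => ‖deriv x t‖ ^ 2) (Ici t₀) ∧
      IntegrableOn (fun t => ‖deriv (deriv x) t‖ ^ 2) (Ici t₀) := by
    have hsub : Ici t₀ ⊆ Ioi 0 := fun t ht => lt_of_lt_of_le ht₀ ht
    constructor
    · refine Integrable.mono' (hint t₀ ht₀)
        (((hx1.continuousOn.mono hsub).norm.pow 2).aestronglyMeasurable measurableSet_Ici)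
        (.of_forall fun t => ?_)
      have : 0 ≤ lam / 2 * ‖deriv (deriv x) t‖ ^ 2 := by positivity
      rw [Real.norm_of_nonneg (by positivity)]
      linarith
    · refine Integrable.mono' ((hint t₀ ht₀).const_mul (2 / lam))
        (((hx2.mono hsub).norm.pow 2).aestronglyMeasurable measurableSet_Ici)
        (.of_forall fun t => ?_)
      have h : 2 / lam * (‖deriv x t‖ ^ 2 + lam / 2 * ‖deriv (deriv x) t‖ ^ 2) =
          2 / lam * ‖deriv x t‖ ^ 2 + ‖deriv (deriv x) t‖ ^ 2 := by
        field_simp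
      have : 0 ≤ 2 / lam * ‖deriv x t‖ ^ 2 := by positivity
      rw [Real.norm_of_nonneg (by positivity), h]
      linarith
  refine ⟨hL2, ?_⟩
  obtain ⟨hu, hv⟩ := hL2 1 one_pos
  have hsub : Ioi (1 : ℝ) ⊆ Ioi 0 := Ioi_subset_Ioi zero_le_one
  have hderiv_int : IntegrableOn
      (fun t => 2 * inner ℝ (deriv x t) (deriv (deriv x) t)) (Ioi (1 : ℝ)) := by
    refine Integrable.mono' ((hu.add hv).mono_set Ioi_subset_Ici_self)
      ((continuousOn_const.mul ((hx1.continuousOn.mono hsub).inner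
        (hx2.mono hsub))).aestronglyMeasurable measurableSet_Ioi) (.of_forall fun t => ?_)
    have h := abs_real_inner_le_norm (deriv x t) (deriv (deriv x) t)
    rw [Real.norm_eq_abs, abs_mul, abs_two, Pi.add_apply]
    linarith [two_mul_le_add_sq ‖deriv x t‖ ‖deriv (deriv x) t‖]
  have hlim : Tendsto (fun t => ‖deriv x t‖ ^ 2) atTop (𝓝 0) :=
    tendsto_zero_of_hasDerivAt_of_integrableOn_Ioi
      (fun t ht => (hdx' t (hsub ht)).norm_sq) hderiv_int (hu.mono_set Ioi_subset_Ici_self)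
  rw [tendsto_zero_iff_norm_tendsto_zero]
  simpa [Real.sqrt_sq (norm_nonneg _)] using hlim.sqrt
end

section
/- Let t₀ ∈ ℝ and let u, g : ℝ → ℝ. Assume u is differentiable on [t₀, ∞) with u(t) ≥ 0 for all t ≥ t₀, u is integrable on [t₀, ∞), u'(t) ≤ g(t) for all t ≥ t₀, and g is integrable on [t₀, ∞). Then u(t) → 0 as t → ∞. -/
open MeasureTheory Filter Topology Set

theorem tendsto_intervalIntegral_sub_one_zero {f : ℝ → ℝ} {a : ℝ}
    (hf : IntegrableOn f (Set.Ici a)) :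
    Tendsto (fun t => ∫ x in (t - 1)..t, f x) atTop (𝓝 0) := by
  have hf' : IntegrableOn f (Set.Ioi a) := hf.mono_set Ioi_subset_Ici_self
  have h₁ := intervalIntegral_tendsto_integral_Ioi a hf' tendsto_id
  have h₂ := intervalIntegral_tendsto_integral_Ioi a hf'
    (tendsto_atTop_add_const_right atTop (-1 : ℝ) tendsto_id)
  have h := h₁.sub h₂
  rw [sub_self] at h
  refine h.congr' ?_
  filter_upwards [eventually_ge_atTop (a + 1)] with t ht
  have hint : ∀ b, a ≤ b → IntervalIntegrable f volume a b := fun b hb =>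
    (intervalIntegrable_iff_integrableOn_Icc_of_le hb).2 (hf.mono_set Icc_subset_Ici_self)
  simp only [id, ← sub_eq_add_neg]
  exact intervalIntegral.integral_interval_sub_left (hint _ (by linarith)) (hint _ (by linarith))

theorem sub_le_intervalIntegral_of_derivWithin_Ici_le {u g : ℝ → ℝ} {a s t : ℝ}
    (hu : DifferentiableOn ℝ u (Set.Ici a))
    (hderiv : ∀ x, a ≤ x → derivWithin u (Set.Ici a) x ≤ g x)
    (hg : IntegrableOn g (Set.Ici a)) (has : a ≤ s) (hst : s ≤ t) :
    u t - u s ≤ ∫ x in s..t, g x := by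
  have hsub : Set.Icc s t ⊆ Set.Ici a := fun x hx => has.trans hx.1
  refine intervalIntegral.sub_le_integral_of_hasDeriv_right_of_le hst (hu.continuousOn.mono hsub)
    (fun x hx => ?_) (hg.mono_set hsub) (fun x hx => hderiv x (has.trans hx.1.le))
  have hax : a ≤ x := has.trans hx.1.le
  exact (hu x hax).hasDerivWithinAt.mono fun y hy => hax.trans (le_of_lt hy)

theorem stmt14 (t₀ : ℝ) (u g : ℝ → ℝ)
    (hu_diff : DifferentiableOn ℝ u (Set.Ici t₀))
    (hu_nonneg : ∀ t, t₀ ≤ t → 0 ≤ u t)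
    (hu_int : IntegrableOn u (Set.Ici t₀))
    (hderiv : ∀ t, t₀ ≤ t → derivWithin u (Set.Ici t₀) t ≤ g t)
    (hg_int : IntegrableOn g (Set.Ici t₀)) :
    Tendsto u atTop (𝓝 0) := by
  have hg_abs : IntegrableOn (fun x => |g x|) (Set.Ici t₀) := hg_int.abs
  have hlim := (tendsto_intervalIntegral_sub_one_zero hu_int).add
    (tendsto_intervalIntegral_sub_one_zero hg_abs)
  rw [add_zero] at hlim
  refine tendsto_of_tendsto_of_tendsto_of_le_of_le' tendsto_const_nhds hlim ?_ ?_
  · filter_upwards [eventually_ge_atTop t₀] with t ht using hu_nonneg t ht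
  filter_upwards [eventually_ge_atTop (t₀ + 1)] with t ht
  have hint : ∀ {f : ℝ → ℝ}, IntegrableOn f (Set.Ici t₀) →
      IntervalIntegrable f volume (t - 1) t := fun hf =>
    (intervalIntegrable_iff_integrableOn_Icc_of_le (by linarith)).2
      (hf.mono_set fun x hx => show t₀ ≤ x by linarith [hx.1])
  have hlower : ∀ s ∈ Set.Icc (t - 1) t, u t - ∫ x in (t - 1)..t, |g x| ≤ u s := by
    intro s hs
    have h₁ := sub_le_intervalIntegral_of_derivWithin_Ici_le hu_diff
      (fun x hx => (hderiv x hx).trans (le_abs_self _)) hg_abs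
      (show t₀ ≤ s by linarith [hs.1]) hs.2
    have h₂ : ∫ x in s..t, |g x| ≤ ∫ x in (t - 1)..t, |g x| :=
      intervalIntegral.integral_mono_interval hs.1 hs.2 le_rfl
        (Eventually.of_forall fun x => abs_nonneg (g x)) (hint hg_abs)
    linarith
  have h := intervalIntegral.integral_mono_on (by linarith) intervalIntegrable_const
    (hint hu_int) hlower
  rw [intervalIntegral.integral_const, sub_sub_cancel, one_smul] at h
  linarith
end
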